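/- arXiv:math/0209284 — 4 statements merged into one kernel-verified Lean document; each statement's English description precedes it below -/
import Mathlib

section
/- Let G be a cancellative, torsion-free abelian monoid and let I be a homogeneous ideal in a commutative G-graded ring R. Then the integral closure \bar{I} of I is again a homogeneous ideal: for every x ∈ R integral over I, each homogeneous component of x is integral over I. -/
/-- `x` is integral over the ideal `I`: there are `m ≥ 1` and `a j ∈ I ^ j` (`j = 1, …, m`)
with `x ^ m + a 1 * x ^ (m - 1) + ⋯ + a m = 0`. -/
def IdealIntegral {R : Type*} [CommRing R] (I : Ideal R) (x : R) : Prop :=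
  ∃ m : ℕ, 0 < m ∧ ∃ a : ℕ → R, (∀ j ∈ Finset.Icc 1 m, a j ∈ I ^ j) ∧
    x ^ m + ∑ j ∈ Finset.Icc 1 m, a j * x ^ (m - j) = 0

open Polynomial

/-- A cancellative torsion-free commutative monoid embeds in a `ℚ`-vector space, hence carries a
compatible linear order. -/
theorem IsAddTorsionFree.exists_linearOrder (G : Type*) [AddCancelCommMonoid G]
    [IsAddTorsionFree G] : ∃ _ : LinearOrder G, IsOrderedCancelAddMonoid G := by
  classical
  let V := DivisibleHull (Algebra.GrothendieckAddGroup G)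
  let b := Module.Basis.ofVectorSpace ℚ V
  let : LinearOrder (Module.Basis.ofVectorSpaceIndex ℚ V) := linearOrderOfSTO WellOrderingRel
  let e : V →+ Lex (Module.Basis.ofVectorSpaceIndex ℚ V →₀ ℚ) :=
    { toFun v := toLex (b.repr v)
      map_zero' := by simp
      map_add' v w := by simp }
  have he : Function.Injective e := toLex.injective.comp b.repr.injective
  let f := e.comp ((DivisibleHull.coeAddMonoidHom _).comp (Algebra.GrothendieckAddGroup.of (M := G)))
  have hf : Function.Injective f := he.comp
    (DivisibleHull.coe_injective.comp Algebra.GrothendieckAddGroup.of_injective)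
  let : LinearOrder G := LinearOrder.lift' f hf
  exact ⟨inferInstance, Function.Injective.isOrderedCancelAddMonoid f (map_add f) .rfl⟩

theorem RingHom.IsIntegralElem.of_range_le {A C B : Type*} [CommRing A] [CommRing C] [CommRing B]
    {f : A →+* B} {h : C →+* B} (hfh : ∀ a, f a ∈ Set.range h) {x : B}
    (hx : f.IsIntegralElem x) : h.IsIntegralElem x := by
  obtain ⟨p, hp, hpx⟩ := hx
  obtain ⟨q, hq, -, hqm⟩ := lifts_and_natDegree_eq_and_monic (f := h) (p := p.map f)
    ((lifts_iff_coeff_lifts _).2 fun n ↦ by rw [coeff_map]; exact hfh _) (hp.map f)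
  exact ⟨q, hqm, by rw [← eval_map, hq, eval_map, hpx]⟩

namespace AddMonoidAlgebra

theorem coeff_mul_mem {G B : Type*} [AddMonoid G] [Ring B] (N : AddSubgroup B)
    {y z : AddMonoidAlgebra B G} (h : ∀ i j, y.coeff i * z.coeff j ∈ N) (g : G) :
    (y * z).coeff g ∈ N := by
  classical
  rw [coeff_mul]
  refine sum_mem fun i _ ↦ sum_mem fun j _ ↦ ?_
  dsimp only
  split_ifs
  exacts [h i j, N.zero_mem]

theorem mem_range_mapRingHom {G A B : Type*} [AddMonoid G] [Semiring A] [Semiring B] {f : A →+* B}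
    {y : AddMonoidAlgebra B G} (h : ∀ g, y.coeff g ∈ Set.range f) :
    y ∈ Set.range (mapRingHom G f) := by
  choose c hc using h
  refine ⟨∑ g ∈ y.coeff.support, single g (c g), ?_⟩
  simp only [map_sum, mapRingHom_single, hc]
  exact sum_coeff_single y

section Ordered

variable {G : Type*} [AddCommMonoid G] [LinearOrder G] [IsOrderedCancelAddMonoid G]

theorem coeff_mul_add_of_forall_le {B : Type*} [Semiring B] {y z : AddMonoidAlgebra B G} {g h : G}
    (hy : ∀ i ∈ y.coeff.support, i ≤ g) (hz : ∀ i ∈ z.coeff.support, i ≤ h) :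
    (y * z).coeff (g + h) = y.coeff g * z.coeff h := by
  refine coeff_mul_add_of_uniqueAdd fun i j hi hj hij ↦ ?_
  exact (add_eq_add_iff_eq_and_eq (hy i hi) (hz j hj)).1 hij

theorem le_nsmul_of_mem_support_pow {B : Type*} [Semiring B] {y : AddMonoidAlgebra B G} {g : G}
    (hy : ∀ i ∈ y.coeff.support, i ≤ g) (n : ℕ) :
    ∀ i ∈ (y ^ n).coeff.support, i ≤ n • g := by
  classical
  induction n with
  | zero =>
    intro i hi
    rw [pow_zero, one_def] at hi
    have := Finsupp.support_single_subset hi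
    simp_all
  | succ n ih =>
    intro i hi
    rw [pow_succ] at hi
    obtain ⟨a, ha, b, hb, rfl⟩ := Finset.mem_add.1 (support_coeff_mul_subset _ _ hi)
    rw [succ_nsmul]
    exact add_le_add (ih a ha) (hy b hb)

theorem coeff_pow_nsmul_of_forall_le {B : Type*} [Semiring B] {y : AddMonoidAlgebra B G} {g : G}
    (hy : ∀ i ∈ y.coeff.support, i ≤ g) (n : ℕ) :
    (y ^ n).coeff (n • g) = y.coeff g ^ n := by
  induction n with
  | zero => simp [one_def]
  | succ n ih =>
    rw [pow_succ, succ_nsmul, coeff_mul_add_of_forall_le (le_nsmul_of_mem_support_pow hy n) hy, ih,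
      pow_succ]

end Ordered

variable {A B : Type*} [CommRing A] [CommRing B] [Algebra A B]

/-- The coefficients of the powers of an element of `B[G]` integral over `A[G]` all lie in a
finitely generated module over a finitely generated subring of `A`. -/
theorem exists_fg_forall_coeff_pow_mem {G : Type*} [AddCommMonoid G] {y : AddMonoidAlgebra B G}
    (hy : (mapRingHom G (algebraMap A B)).IsIntegralElem y) :
    ∃ (A₀ : Subalgebra ℤ A) (N : Submodule A₀ B), A₀.FG ∧ N.FG ∧
      ∀ n g, (y ^ n).coeff g ∈ N := by
  classical
  obtain ⟨p, hp, hpy⟩ := hy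
  let s : Finset A := (Finset.range p.natDegree).biUnion fun i ↦
    (p.coeff i).coeff.support.image (p.coeff i).coeff
  let A₀ := Algebra.adjoin ℤ (s : Set A)
  have hs : ∀ i < p.natDegree, ∀ g, (p.coeff i).coeff g ∈ A₀ := fun i hi g ↦ by
    by_cases h : (p.coeff i).coeff g = 0
    · rw [h]; exact A₀.zero_mem
    · refine Algebra.subset_adjoin ?_
      simp only [s, Finset.coe_biUnion, Set.mem_iUnion, Finset.mem_coe, Finset.mem_range,
        Finset.mem_image]
      exact ⟨i, hi, g, by simpa using h, rfl⟩
  let t : Finset B := (Finset.range p.natDegree).biUnion fun i ↦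
    (y ^ i).coeff.support.image (y ^ i).coeff
  let N : Submodule A₀ B := Submodule.span A₀ (t : Set B)
  refine ⟨A₀, N, ⟨s, rfl⟩, ⟨t, rfl⟩, fun n ↦ ?_⟩
  induction n using Nat.strong_induction_on with
  | _ n ih =>
    intro g
    obtain hn | hn := lt_or_ge n p.natDegree
    · by_cases h : (y ^ n).coeff g = 0
      · rw [h]; exact N.zero_mem
      · refine Submodule.subset_span ?_
        simp only [t, Finset.coe_biUnion, Set.mem_iUnion, Finset.mem_coe, Finset.mem_range,
          Finset.mem_image]
        exact ⟨n, hn, g, by simpa using h, rfl⟩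
    · rw [eval₂_eq_sum_range, Finset.sum_range_succ, hp.coeff_natDegree, map_one, one_mul,
        add_eq_zero_iff_neg_eq] at hpy
      obtain ⟨k, rfl⟩ := Nat.exists_eq_add_of_le hn
      have key : y ^ (p.natDegree + k) = -∑ i ∈ Finset.range p.natDegree,
          mapRingHom G (algebraMap A B) (p.coeff i) * y ^ (i + k) := by
        rw [pow_add, ← hpy, neg_mul, Finset.sum_mul]
        simp only [pow_add, mul_assoc]
      rw [key, coeff_neg, Finsupp.neg_apply, coeff_sum, Finsupp.finsetSum_apply]
      refine N.neg_mem (N.sum_mem fun i hi ↦ coeff_mul_mem N.toAddSubgroup (fun a b ↦ ?_) g)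
      rw [Finset.mem_range] at hi
      rw [coeff_mapRingHom, ← Algebra.smul_def]
      exact N.smul_mem ⟨_, hs i hi a⟩ (ih _ (by omega) b)

/-- The coefficients of an element of `B[G]` integral over `A[G]` are integral over `A`, for `G`
a linearly ordered cancellative commutative monoid. -/
theorem isIntegral_coeff {G : Type*} [AddCommMonoid G] [LinearOrder G]
    [IsOrderedCancelAddMonoid G] {y : AddMonoidAlgebra B G}
    (hy : (mapRingHom G (algebraMap A B)).IsIntegralElem y) (g : G) :
    IsIntegral A (y.coeff g) := by
  classical
  induction hc : y.coeff.support.card using Nat.strong_induction_on generalizing y with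
  | _ c ih =>
    subst hc
    obtain h0 | hne := y.coeff.support.eq_empty_or_nonempty
    · rw [Finsupp.support_eq_empty.1 h0]
      exact isIntegral_zero
    set m := y.coeff.support.max' hne
    have hm : m ∈ y.coeff.support := Finset.max'_mem _ _
    have hle : ∀ i ∈ y.coeff.support, i ≤ m := fun i hi ↦ Finset.le_max' _ i hi
    have hint : IsIntegral A (y.coeff m) := by
      obtain ⟨A₀, N, hA₀, hN, hmem⟩ := exists_fg_forall_coeff_pow_mem hy
      have : Algebra.FiniteType ℤ A₀ := A₀.fg_iff_finiteType.1 hA₀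
      have : IsNoetherianRing A₀ := Algebra.FiniteType.isNoetherianRing ℤ A₀
      have hle' : Subalgebra.toSubmodule (Algebra.adjoin A₀ {y.coeff m}) ≤ N := by
        rw [Algebra.adjoin_singleton_eq_range_aeval]
        rintro _ ⟨q, rfl⟩
        change aeval _ q ∈ N
        rw [aeval_eq_sum_range]
        refine N.sum_mem fun i _ ↦ N.smul_mem _ ?_
        rw [← coeff_pow_nsmul_of_forall_le hle]
        exact hmem _ _
      have hnoeth : IsNoetherian A₀ N := isNoetherian_of_fg_of_noetherian N hN
      have : IsIntegral A₀ (y.coeff m) := isIntegral_of_submodule_noetherian _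
        (isNoetherian_of_le hle') _ (Algebra.self_mem_adjoin_singleton _ _)
      exact this.tower_top
    have hsingle : (mapRingHom G (algebraMap A B)).IsIntegralElem (single m (y.coeff m)) := by
      have h₁ : (mapRingHom G (algebraMap A B)).IsIntegralElem (single m 1) := by
        simpa using (mapRingHom G (algebraMap A B)).isIntegralElem_map (x := single m 1)
      have h₂ : (mapRingHom G (algebraMap A B)).IsIntegralElem (single 0 (y.coeff m)) := by
        refine RingHom.IsIntegralElem.of_range_le (fun a ↦ ⟨single 0 a, ?_⟩)
          (RingHom.IsIntegralElem.map hint (singleZeroRingHom (M := G)))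
        simp
      simpa using RingHom.IsIntegralElem.mul _ h₁ h₂
    have hcoeff : (y - single m (y.coeff m)).coeff = y.coeff.erase m := by
      ext i
      by_cases hi : i = m
      · simp [hi]
      · simp [Finsupp.erase_ne hi, Ne.symm hi]
    have hrec := ih _ ?_ (RingHom.IsIntegralElem.sub _ hy hsingle) rfl
    · by_cases hg : g = m
      · rwa [hg]
      · rwa [hcoeff, Finsupp.erase_ne hg] at hrec
    · rw [hcoeff, Finsupp.support_erase]
      exact Finset.card_erase_lt_of_mem hm

/-- A ring homomorphism `B → B[G]` that maps the image of `A` into `A[G]` sends elements integral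
over `A` to elements with integral coefficients. -/
theorem isIntegral_coeff_map {G : Type*} [AddCommMonoid G] [LinearOrder G]
    [IsOrderedCancelAddMonoid G] (φ : B →+* AddMonoidAlgebra B G)
    (hφ : ∀ a g, (φ (algebraMap A B a)).coeff g ∈ Set.range (algebraMap A B)) {x : B}
    (hx : IsIntegral A x) (g : G) : IsIntegral A ((φ x).coeff g) :=
  isIntegral_coeff (RingHom.IsIntegralElem.of_range_le
    (fun a ↦ mem_range_mapRingHom (hφ a)) (RingHom.IsIntegralElem.map hx φ)) g

end AddMonoidAlgebra

namespace GradedRing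

variable {G R : Type*} [AddCommMonoid G] [DecidableEq G] [CommRing R]
  (𝒜 : G → AddSubgroup R) [GradedRing 𝒜]

/-- The coaction `r ↦ ∑ g, r_g e^g` of a `G`-graded ring `R`. -/
noncomputable def coaction : R →+* AddMonoidAlgebra R G :=
  (DirectSum.toSemiring
    (fun g ↦ (AddMonoidAlgebra.singleAddHom g).comp (𝒜 g).subtype)
    (by simp [AddMonoidAlgebra.one_def])
    (by simp)).comp (DirectSum.decomposeRingEquiv 𝒜).toRingHom

theorem coeff_coaction (r : R) (g : G) :
    (coaction 𝒜 r).coeff g = DirectSum.decompose 𝒜 r g := by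
  classical
  induction r using DirectSum.Decomposition.inductionOn 𝒜 with
  | zero => simp
  | homogeneous r =>
    rename_i i
    have : coaction 𝒜 r = AddMonoidAlgebra.single i (r : R) := by
      simp [coaction, DirectSum.decomposeRingEquiv]
    rw [this, DirectSum.decompose_coe, DirectSum.coe_of_apply]
    by_cases h : i = g <;> simp [h]
  | add r s hr hs => simp [hr, hs]

/-- The coaction of a `G`-graded ring, extended to polynomials with `X` in degree zero. -/
noncomputable def polynomialCoaction : R[X] →+* AddMonoidAlgebra R[X] G :=
  eval₂RingHom ((AddMonoidAlgebra.mapRingHom G C).comp (coaction 𝒜)) (AddMonoidAlgebra.single 0 X)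

theorem coeff_polynomialCoaction_monomial (n : ℕ) (r : R) (g : G) :
    (polynomialCoaction 𝒜 (monomial n r)).coeff g =
      monomial n (DirectSum.decompose 𝒜 r g : R) := by
  rw [polynomialCoaction, coe_eval₂RingHom, eval₂_monomial, AddMonoidAlgebra.single_pow,
    nsmul_zero, AddMonoidAlgebra.coeff_mul_single_zero, RingHom.comp_apply,
    AddMonoidAlgebra.coeff_mapRingHom, coeff_coaction, C_mul_X_pow_eq_monomial]

theorem coeff_coeff_polynomialCoaction (q : R[X]) (g : G) (n : ℕ) :
    ((polynomialCoaction 𝒜 q).coeff g).coeff n = DirectSum.decompose 𝒜 (q.coeff n) g := by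
  induction q using Polynomial.induction_on' with
  | add p q hp hq => simp [hp, hq]
  | monomial k r =>
    rw [coeff_polynomialCoaction_monomial, coeff_monomial, coeff_monomial]
    split_ifs <;> simp

theorem _root_.Ideal.IsHomogeneous.pow {I : Ideal R} (hI : I.IsHomogeneous 𝒜) (n : ℕ) :
    (I ^ n).IsHomogeneous 𝒜 := by
  induction n with
  | zero => simpa using Ideal.IsHomogeneous.top 𝒜
  | succ n ih => exact pow_succ I n ▸ ih.mul hI

end GradedRing

theorem IdealIntegral.isIntegral_monomial {R : Type*} [CommRing R] {I : Ideal R} {x : R}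
    (hx : IdealIntegral I x) : IsIntegral (reesAlgebra I) (monomial 1 x : R[X]) := by
  obtain ⟨m, hm, a, ha, hax⟩ := hx
  classical
  let b : ℕ → reesAlgebra I := fun j ↦
    if h : a j ∈ I ^ j then ⟨monomial j (a j), reesAlgebra.monomial_mem.2 h⟩ else 0
  have hb : ∀ j ∈ Finset.Icc 1 m, (b j : R[X]) = monomial j (a j) := fun j hj ↦ by
    simp [b, ha j hj]
  refine ⟨X ^ m + ∑ j ∈ Finset.Icc 1 m, C (b j) * X ^ (m - j), ?_, ?_⟩
  · refine monic_X_pow_add (mem_degreeLT.1 (sum_mem fun j hj ↦ mem_degreeLT.2 ?_))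
    rw [Finset.mem_Icc] at hj
    exact (degree_C_mul_X_pow_le _ _).trans_lt (by exact_mod_cast (by omega : m - j < m))
  · have : ∀ j ∈ Finset.Icc 1 m, eval₂ (algebraMap (reesAlgebra I) R[X]) (monomial 1 x)
        (C (b j) * X ^ (m - j)) = monomial m (a j * x ^ (m - j)) := fun j hj ↦ by
      rw [eval₂_mul, eval₂_C, eval₂_X_pow, Subalgebra.algebraMap_apply, hb j hj, monomial_pow,
        monomial_mul_monomial]
      rw [Finset.mem_Icc] at hj
      congr 2
      omega
    rw [eval₂_add, eval₂_X_pow, eval₂_finsetSum, Finset.sum_congr rfl this, ← map_sum, monomial_pow,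
      one_mul, ← map_add, hax, map_zero]

theorem IdealIntegral.of_isIntegral_monomial {R : Type*} [CommRing R] {I : Ideal R} {x : R}
    (hx : IsIntegral (reesAlgebra I) (monomial 1 x : R[X])) : IdealIntegral I x := by
  obtain ⟨p, hp, hpx⟩ := hx
  obtain _ | _ := subsingleton_or_nontrivial R
  · exact ⟨1, one_pos, 0, by simp, Subsingleton.elim _ _⟩
  have hpos : 0 < p.natDegree := by
    refine Nat.pos_of_ne_zero fun h ↦ ?_
    rw [hp.natDegree_eq_zero.1 h, eval₂_one] at hpx
    exact one_ne_zero hpx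
  refine ⟨p.natDegree, hpos,
    fun j ↦ (p.coeff (p.natDegree - j) : R[X]).coeff j, fun j _ ↦ ?_, ?_⟩
  · exact (mem_reesAlgebra_iff I _).1 (p.coeff _).2 j
  · replace hpx := congr_arg (fun q : R[X] ↦ q.coeff p.natDegree) hpx
    simp only [eval₂_eq_sum_range, finsetSum_coeff, coeff_zero, monomial_pow, one_mul] at hpx
    rw [← hpx, Finset.sum_range_succ, hp.coeff_natDegree, map_one, one_mul, coeff_monomial_same,
      add_comm]
    congr 1
    refine Finset.sum_bij' (fun j _ ↦ p.natDegree - j) (fun i _ ↦ p.natDegree - i)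
      ?_ ?_ ?_ ?_ ?_
    · intro j hj; simp at hj ⊢; omega
    · intro j hj; simp at hj ⊢; omega
    · intro j hj; simp at hj ⊢; omega
    · intro j hj; simp at hj ⊢; omega
    · intro j hj
      rw [Finset.mem_Icc] at hj
      rw [Subalgebra.algebraMap_apply]
      obtain ⟨k, hk⟩ := Nat.exists_eq_add_of_le hj.2
      rw [hk, Nat.add_sub_cancel_left, coeff_mul_monomial]
      simp only [Nat.add_sub_cancel_left]

/-- Let `G` be a cancellative, torsion-free abelian monoid and `I` a
homogeneous ideal in a commutative `G`-graded ring `R`.  Then the integral closure of `I`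
is again homogeneous: each homogeneous component of an element integral over `I` is
integral over `I`. -/
theorem integral_closure_of_homogeneous_ideal_is_homogeneous
    {G : Type*} [AddCancelCommMonoid G] [DecidableEq G]
    -- `G` is torsion-free
    (htf : ∀ (f g : G) (k : ℕ), 0 < k → k • f = k • g → f = g)
    {R : Type*} [CommRing R]
    (𝒜 : G → AddSubgroup R) [GradedRing 𝒜]
    (I : Ideal R)
    -- `I` is homogeneous: it contains all homogeneous components of its elements
    (hI : ∀ x ∈ I, ∀ g : G, (DirectSum.decompose 𝒜 x g : R) ∈ I)
    (x : R) (hx : IdealIntegral I x) (g : G) :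
    IdealIntegral I ((DirectSum.decompose 𝒜 x g : R)) := by
  have : IsAddTorsionFree G := ⟨fun n hn f g h ↦ htf f g n (Nat.pos_of_ne_zero hn) h⟩
  obtain ⟨_, _⟩ := IsAddTorsionFree.exists_linearOrder G
  have hI' : I.IsHomogeneous 𝒜 := fun g x hx ↦ hI x hx g
  refine IdealIntegral.of_isIntegral_monomial ?_
  rw [← GradedRing.coeff_polynomialCoaction_monomial]
  refine AddMonoidAlgebra.isIntegral_coeff_map (GradedRing.polynomialCoaction 𝒜)
    (fun q g ↦ ⟨⟨_, ?_⟩, rfl⟩) hx.isIntegral_monomial g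
  refine (mem_reesAlgebra_iff I _).2 fun n ↦ ?_
  refine (GradedRing.coeff_coeff_polynomialCoaction 𝒜 _ g n).symm ▸ ?_
  exact hI'.pow 𝒜 n g ((mem_reesAlgebra_iff I _).1 q.2 n)
end

section
/- Let I be a monomial ideal in the polynomial ring R = K[x_1,…,x_n] over a field K, with n ≥ 1. If I^m is integrally closed for m = 1, …, n−1, then I is normal, i.e., I^m is integrally closed for every positive integer m. -/
open MvPolynomial

/-- A conic Carathéodory lemma which does not decrease the total weight. -/
theorem exists_conic_combination_card_le_finrank {ι κ : Type*} [Fintype κ] (v : ι → κ → ℚ)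
    (hv : ∀ a, 0 ≤ v a) (s : Finset ι) (hs : ∀ a ∈ s, v a ≠ 0) (c : ι → ℚ)
    (hc : ∀ a ∈ s, 0 ≤ c a) :
    ∃ t ⊆ s, ∃ d : ι → ℚ, t.card ≤ Fintype.card κ ∧ (∀ a ∈ t, 0 ≤ d a) ∧
      ∑ a ∈ s, c a ≤ ∑ a ∈ t, d a ∧ ∑ a ∈ t, d a • v a = ∑ a ∈ s, c a • v a := by
  classical
  induction s using Finset.strongInduction generalizing c with
  | H s ih =>
    by_cases hcard : s.card ≤ Fintype.card κ
    · exact ⟨s, subset_rfl, c, hcard, hc, le_rfl, rfl⟩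
    have hdep : ¬ LinearIndepOn ℚ v (s : Set ι) := fun h => hcard <| by
      simpa using LinearIndependent.fintype_card_le_finrank h
    obtain ⟨e, he, hpos, a₁, ha₁, hea₁⟩ : ∃ e : ι → ℚ, ∑ a ∈ s, e a • v a = 0 ∧
        0 ≤ ∑ a ∈ s, e a ∧ ∃ a ∈ s, e a ≠ 0 := by
      rw [linearIndepOn_finset_iff] at hdep
      push Not at hdep
      obtain ⟨e, he, a, ha, hea⟩ := hdep
      rcases le_total 0 (∑ a ∈ s, e a) with h | h
      · exact ⟨e, he, h, a, ha, hea⟩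
      · exact ⟨fun a => -e a, by simp [he], by simpa using h, a, ha, by simpa using hea⟩
    obtain ⟨a₂, ha₂, hea₂⟩ : ∃ a ∈ s, e a < 0 := by
      by_contra! hnn
      have hz := (Finset.sum_eq_zero_iff_of_nonneg
        (fun a ha => smul_nonneg (hnn a ha) (hv a))).1 he a₁ ha₁
      exact (smul_eq_zero.1 hz).elim hea₁ (hs a₁ ha₁)
    obtain ⟨a₀, ha₀, hmin⟩ := Finset.exists_min_image (s.filter fun a => e a < 0)
      (fun a => c a / -e a) ⟨a₂, Finset.mem_filter.2 ⟨ha₂, hea₂⟩⟩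
    obtain ⟨ha₀s, hea₀⟩ := Finset.mem_filter.1 ha₀
    set t := c a₀ / -e a₀ with ht
    have ht0 : 0 ≤ t := div_nonneg (hc a₀ ha₀s) (by linarith)
    have hzero : c a₀ + t * e a₀ = 0 := by
      rw [ht, div_neg, neg_mul, div_mul_cancel₀ _ hea₀.ne, add_neg_cancel]
    have hnonneg : ∀ a ∈ s, 0 ≤ c a + t * e a := by
      intro a ha
      rcases lt_or_ge (e a) 0 with h | h
      · have := hmin a (Finset.mem_filter.2 ⟨ha, h⟩)
        rw [le_div_iff₀ (by linarith)] at this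
        linarith
      · have := hc a ha
        positivity
    obtain ⟨u, hu, d, hcard', hd, hsum, hcomb⟩ := ih (s.erase a₀) (Finset.erase_ssubset ha₀s)
      (fun a ha => hs a (Finset.mem_of_mem_erase ha)) (fun a => c a + t * e a)
      (fun a ha => hnonneg a (Finset.mem_of_mem_erase ha))
    refine ⟨u, hu.trans (Finset.erase_subset _ _), d, hcard', hd, le_trans ?_ hsum, ?_⟩
    · rw [Finset.sum_erase s hzero, Finset.sum_add_distrib, ← Finset.mul_sum]
      have := mul_nonneg ht0 hpos
      linarith
    · rw [hcomb, Finset.sum_erase s (by rw [hzero, zero_smul])]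
      simp only [add_smul, mul_smul, Finset.sum_add_distrib, ← Finset.smul_sum, he, smul_zero,
        add_zero]

/-- The exponents of a power of a monomial ideal dominate sums of exponents of generators. -/
theorem exists_multiset_sum_le_of_mem_span_monomial_pow {σ R : Type*} [CommRing R]
    {A : Set (σ →₀ ℕ)} {k : ℕ} {f : MvPolynomial σ R}
    (hf : f ∈ (Ideal.span ((fun α => monomial α (1 : R)) '' A)) ^ k)
    {β : σ →₀ ℕ} (hβ : β ∈ f.support) :
    ∃ s : Multiset (σ →₀ ℕ), s.card = k ∧ (∀ a ∈ s, a ∈ A) ∧ s.sum ≤ β := by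
  classical
  induction k generalizing f β with
  | zero => exact ⟨0, by simp⟩
  | succ k ih =>
    rw [pow_succ] at hf
    induction hf using Submodule.mul_induction_on' generalizing β with
    | mem_mul_mem g hg h hh =>
      obtain ⟨γ, hγ, δ, hδ, rfl⟩ := Finset.mem_add.1 (support_mul g h hβ)
      obtain ⟨s, hs, hsA, hsγ⟩ := ih hg hγ
      obtain ⟨a, ha, haδ⟩ := mem_ideal_span_monomial_image.1 hh δ hδ
      refine ⟨a ::ₘ s, by simp [hs], by simpa [ha] using hsA, ?_⟩
      rw [Multiset.sum_cons, add_comm]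
      exact add_le_add hsγ haδ
    | add g _ h _ ihg ihh =>
      rcases Finset.mem_union.1 (support_add hβ) with hβ | hβ
      exacts [ihg hβ, ihh hβ]

theorem monomial_mem_of_le {σ R : Type*} [CommRing R] {J : Ideal (MvPolynomial σ R)}
    {α β : σ →₀ ℕ} (h : α ≤ β) (hα : monomial α (1 : R) ∈ J) (r : R) : monomial β r ∈ J := by
  have : monomial β r = monomial (β - α) r * monomial α 1 := by
    rw [monomial_mul, tsub_add_cancel_of_le h, mul_one]
  exact this ▸ J.mul_mem_left _ hα

theorem monomial_mem_span {σ R : Type*} [CommRing R] {A : Set (σ →₀ ℕ)} {a : σ →₀ ℕ}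
    (ha : a ∈ A) : monomial a (1 : R) ∈ Ideal.span ((fun α => monomial α (1 : R)) '' A) :=
  Ideal.subset_span ⟨a, ha, rfl⟩

theorem monomial_sum_mem_pow {σ R ι : Type*} [CommRing R] {J : Ideal (MvPolynomial σ R)}
    (t : Finset ι) (v : ι → σ →₀ ℕ) (hv : ∀ a ∈ t, monomial (v a) (1 : R) ∈ J) (c : ι → ℕ) :
    monomial (∑ a ∈ t, c a • v a) (1 : R) ∈ J ^ ∑ a ∈ t, c a := by
  rw [monomial_sum_one, ← Finset.prod_pow_eq_pow_sum]
  refine Ideal.prod_mem_prod fun a ha => ?_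
  rw [← one_pow (c a), ← monomial_pow]
  exact Ideal.pow_mem_pow (hv a ha) _

theorem monomial_mem_span_pow_of_mem_support {σ R : Type*} [CommRing R]
    {A : Set (σ →₀ ℕ)} {k : ℕ} {f : MvPolynomial σ R}
    (hf : f ∈ (Ideal.span ((fun α => monomial α (1 : R)) '' A)) ^ k)
    {β : σ →₀ ℕ} (hβ : β ∈ f.support) (r : R) :
    monomial β r ∈ (Ideal.span ((fun α => monomial α (1 : R)) '' A)) ^ k := by
  classical
  obtain ⟨s, hs, hsA, hsβ⟩ := exists_multiset_sum_le_of_mem_span_monomial_pow hf hβ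
  refine monomial_mem_of_le hsβ ?_ r
  rw [Finset.sum_multiset_count, ← hs, ← Multiset.toFinset_sum_count_eq]
  exact monomial_sum_mem_pow _ id
    (fun a ha => monomial_mem_span (hsA a (Multiset.mem_toFinset.1 ha))) _

theorem idealIntegral_monomial {σ R : Type*} [CommRing R] {J : Ideal (MvPolynomial σ R)}
    {α : σ →₀ ℕ} {N : ℕ} (hN : 0 < N) (h : monomial (N • α) (1 : R) ∈ J ^ N) :
    IdealIntegral J (monomial α (1 : R)) := by
  refine ⟨N, hN, fun j => if j = N then -monomial (N • α) 1 else 0, fun j _ => ?_, ?_⟩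
  · dsimp only
    split_ifs with hj
    · rw [hj]
      exact neg_mem h
    · exact zero_mem _
  · rw [Finset.sum_eq_single N (fun j _ hj => by simp [hj])
      (fun hN' => absurd (Finset.mem_Icc.2 ⟨hN, le_rfl⟩) hN')]
    simp [monomial_pow]

/-- If `m` is at least the number of variables, one generator can be split off from a
monomial integral over `I ^ m` in such a way that the quotient is integral over `I ^ (m - 1)`. -/
theorem exists_le_and_monomial_nsmul_sub_mem {σ R : Type*} [Fintype σ] [CommRing R] [Nontrivial R]
    {A : Set (σ →₀ ℕ)} (hA : 0 ∉ A) {m N : ℕ} (hm : Fintype.card σ ≤ m) (hm0 : 0 < m)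
    (hN : 0 < N) {α : σ →₀ ℕ}
    (h : monomial (N • α) (1 : R) ∈ (Ideal.span ((fun α => monomial α (1 : R)) '' A)) ^ (m * N)) :
    ∃ a ∈ A, a ≤ α ∧ ∃ M, 0 < M ∧ monomial (M • (α - a)) (1 : R) ∈
      (Ideal.span ((fun α => monomial α (1 : R)) '' A)) ^ ((m - 1) * M) := by
  classical
  obtain ⟨s, hs, hsA, hsα⟩ := exists_multiset_sum_le_of_mem_span_monomial_pow h
    (show N • α ∈ _ by simp)
  let v : (σ →₀ ℕ) → σ → ℚ := fun a i => a i
  obtain ⟨t, hts, d, hcard, hd, hsum, hcomb⟩ := exists_conic_combination_card_le_finrank v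
    (fun a i => Nat.cast_nonneg _) s.toFinset
    (fun a ha h0 => hA <| by
      have : a = 0 := Finsupp.ext fun i => by simpa [v] using congrFun h0 i
      exact this ▸ hsA a (Multiset.mem_toFinset.1 ha))
    (fun a => s.count a) (fun a _ => Nat.cast_nonneg _)
  have htA : ∀ a ∈ t, a ∈ A := fun a ha => hsA a (Multiset.mem_toFinset.1 (hts ha))
  have hsum' : (m * N : ℚ) ≤ ∑ a ∈ t, d a := by
    refine le_trans (le_of_eq ?_) hsum
    rw [← Nat.cast_sum, Multiset.toFinset_sum_count_eq, hs, Nat.cast_mul]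
  have hle : ∀ i, ∑ a ∈ t, d a * a i ≤ N * α i := by
    intro i
    have h1 := congrFun hcomb i
    simp only [Finset.sum_apply, Pi.smul_apply, smul_eq_mul, v] at h1
    rw [h1]
    have h2 := hsα i
    rw [Finset.sum_multiset_count, Finsupp.finsetSum_apply] at h2
    simp only [Finsupp.smul_apply, smul_eq_mul] at h2
    exact_mod_cast h2
  have hN' : (0 : ℚ) < N := by exact_mod_cast hN
  have hm0' : (0 : ℚ) < m := by exact_mod_cast hm0
  obtain ⟨b, hbt, hb⟩ : ∃ b ∈ t, (N : ℚ) ≤ d b := by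
    by_contra! hlt
    rcases t.eq_empty_or_nonempty with rfl | hne
    · have := mul_pos hm0' hN'
      simp only [Finset.sum_empty] at hsum'
      linarith
    · have h1 := Finset.sum_lt_sum_of_nonempty hne hlt
      rw [Finset.sum_const, nsmul_eq_mul] at h1
      have h2 : (t.card : ℚ) ≤ m := by exact_mod_cast hcard.trans hm
      nlinarith
  have hbα : b ≤ α := fun i => by
    have h1 := Finset.single_le_sum (f := fun a => d a * (a i : ℚ))
      (fun a ha => mul_nonneg (hd a ha) (Nat.cast_nonneg _)) hbt
    have h2 : (N : ℚ) * b i ≤ N * α i :=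
      (mul_le_mul_of_nonneg_right hb (Nat.cast_nonneg _)).trans (h1.trans (hle i))
    exact_mod_cast le_of_mul_le_mul_left h2 hN'
  obtain ⟨D, hD, c, hc⟩ : ∃ D : ℕ, 0 < D ∧ ∃ c : (σ →₀ ℕ) → ℕ, ∀ a ∈ t,
      (c a : ℚ) = D * (d a - if a = b then (N : ℚ) else 0) := by
    have hq : ∀ a ∈ t, 0 ≤ d a - if a = b then (N : ℚ) else 0 := by
      intro a ha
      split_ifs with hab
      · rw [hab]; linarith
      · simpa using hd a ha
    obtain ⟨q, hqd⟩ : ∃ q : (σ →₀ ℕ) → ℚ, ∀ a, d a - (if a = b then (N : ℚ) else 0) = q a :=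
      ⟨_, fun _ => rfl⟩
    simp only [hqd] at hq ⊢
    refine ⟨∏ a ∈ t, (q a).den, Finset.prod_pos fun a _ => (q a).den_pos,
      fun a => (∏ x ∈ t.erase a, (q x).den) * (q a).num.toNat, fun a ha => ?_⟩
    rw [← Finset.prod_erase_mul t _ ha]
    push_cast
    rw [mul_assoc]
    congr 1
    have h1 : (((q a).num.toNat : ℤ) : ℚ) = ((q a).num : ℚ) := by
      rw [Int.toNat_of_nonneg (Rat.num_nonneg.2 (hq a ha))]
    rw [mul_comm, Rat.mul_den_eq_num, ← h1, Int.cast_natCast]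
  refine ⟨b, htA b hbt, hbα, D * N, Nat.mul_pos hD hN, ?_⟩
  have hD' : (0 : ℚ) ≤ D := Nat.cast_nonneg _
  have hle' : ∑ a ∈ t, c a • a ≤ (D * N) • (α - b) := fun i => by
    rw [Finsupp.finsetSum_apply]
    simp only [Finsupp.smul_apply, smul_eq_mul, Finsupp.tsub_apply]
    have h1 : ((∑ a ∈ t, c a * a i : ℕ) : ℚ) = D * (∑ a ∈ t, d a * a i - N * b i) := by
      push_cast
      rw [Finset.sum_congr rfl fun a ha => by rw [hc a ha]]
      simp_rw [mul_assoc, sub_mul, ite_mul, zero_mul]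
      rw [← Finset.mul_sum, Finset.sum_sub_distrib, Finset.sum_ite_eq' t b, if_pos hbt]
    have h2 : ((∑ a ∈ t, c a * a i : ℕ) : ℚ) ≤ ((D * N * (α i - b i) : ℕ) : ℚ) := by
      rw [h1, Nat.cast_mul, Nat.cast_sub (hbα i), Nat.cast_mul, mul_assoc]
      exact mul_le_mul_of_nonneg_left (by linarith [hle i]) hD'
    exact_mod_cast h2
  refine monomial_mem_of_le hle' (Ideal.pow_le_pow_right ?_ (monomial_sum_mem_pow t id
    (fun a ha => monomial_mem_span (htA a ha)) c)) _
  have h1 : ((∑ a ∈ t, c a : ℕ) : ℚ) = D * (∑ a ∈ t, d a - N) := by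
    push_cast
    rw [Finset.sum_congr rfl hc, ← Finset.mul_sum, Finset.sum_sub_distrib,
      Finset.sum_ite_eq' t b, if_pos hbt]
  have h2 : (((m - 1) * (D * N) : ℕ) : ℚ) ≤ ((∑ a ∈ t, c a : ℕ) : ℚ) := by
    rw [h1, Nat.cast_mul, Nat.cast_sub hm0, Nat.cast_mul, Nat.cast_one, mul_left_comm]
    exact mul_le_mul_of_nonneg_left (by linarith) hD'
  exact_mod_cast h2

/-- The homomorphism `x ^ α ↦ x ^ α t ^ α` into polynomials in auxiliary variables `t`. -/
noncomputable def multidegreeHom (σ R : Type*) [CommRing R] :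
    MvPolynomial σ R →ₐ[R] MvPolynomial σ (MvPolynomial σ R) :=
  aeval fun i => C (X i) * X i

theorem coeff_multidegreeHom {σ R : Type*} [CommRing R] (f : MvPolynomial σ R) (β : σ →₀ ℕ) :
    coeff β (multidegreeHom σ R f) = monomial β (coeff β f) := by
  classical
  induction f using MvPolynomial.induction_on' with
  | monomial u r =>
    have : multidegreeHom σ R (monomial u r) = monomial u (monomial u r) := by
      rw [multidegreeHom, aeval_monomial, monomial_eq (s := u) (a := monomial u r),
        monomial_eq (s := u) (a := r)]
      simp only [mul_pow, Finsupp.prod, Finset.prod_mul_distrib, map_mul, map_prod, map_pow,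
        IsScalarTower.algebraMap_apply R (MvPolynomial σ R) (MvPolynomial σ (MvPolynomial σ R)),
        algebraMap_eq]
      ring
    rw [this, coeff_monomial, coeff_monomial]
    split_ifs with h
    · rw [h]
    · simp
  | add p q hp hq => simp [hp, hq]

/-- An equation of integral dependence over an ideal `J` gives one over any ring containing the
homogeneous elements `Φ g * T ^ j` with `g ∈ J ^ j` of the Rees algebra. -/
theorem IdealIntegral.isIntegral_map_mul {A B S : Type*} [CommRing A] [CommRing B] [CommRing S]
    [Algebra S B] {J : Ideal A} {f : A} (hf : IdealIntegral J f) (Φ : A →+* B) (T : B)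
    (hT : ∀ j, ∀ g ∈ J ^ j, ∃ b : S, algebraMap S B b = Φ g * T ^ j) :
    IsIntegral S (Φ f * T) := by
  obtain ⟨m, hm, a, ha, he⟩ := hf
  choose! b hb using fun j (hj : j ∈ Finset.Icc 1 m) => hT j (a j) (ha j hj)
  refine ⟨Polynomial.X ^ m + ∑ j ∈ Finset.Icc 1 m,
    Polynomial.C (b j) * Polynomial.X ^ (m - j), ?_, ?_⟩
  · refine Polynomial.monic_X_pow_add ?_
    rw [Polynomial.degree_lt_iff_coeff_zero]
    intro k hk
    rw [Polynomial.finsetSum_coeff]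
    refine Finset.sum_eq_zero fun j hj => ?_
    rw [Polynomial.coeff_C_mul_X_pow, if_neg]
    have := Finset.mem_Icc.1 hj
    omega
  · have h := congrArg (fun x => T ^ m * Φ x) he
    simp only [map_add, map_sum, map_mul, map_pow, map_zero, mul_zero, mul_add,
      Finset.mul_sum] at h
    rw [← h]
    simp only [Polynomial.eval₂_add, Polynomial.eval₂_finsetSum, Polynomial.eval₂_mul,
      Polynomial.eval₂_pow, Polynomial.eval₂_X, Polynomial.eval₂_C]
    rw [mul_pow, mul_comm (T ^ m)]
    congr 1
    refine Finset.sum_congr rfl fun j hj => ?_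
    rw [hb j hj, mul_pow, ← pow_mul_pow_sub T (Finset.mem_Icc.1 hj).2]
    ring

theorem IdealIntegral.isIntegral_coeff_map_mul {σ A P S : Type*} [CommRing A] [CommRing P]
    [CommRing S] [Algebra S P] {J : Ideal A} {f : A} (hf : IdealIntegral J f)
    (Φ : A →+* MvPolynomial σ P) (T : P)
    (hT : ∀ j, ∀ g ∈ J ^ j, ∀ γ, coeff γ (Φ g) * T ^ j ∈ Set.range (algebraMap S P))
    (β : σ →₀ ℕ) : IsIntegral S (coeff β (Φ f) * T) := by
  let _ := algebraMvPolynomial (σ := σ) (R := S) (S := P)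
  have hint : IsIntegral (MvPolynomial σ S) (Φ f * C T) := by
    refine hf.isIntegral_map_mul (B := MvPolynomial σ P) Φ (C T) fun j g hg => ?_
    refine mem_range_map_iff_coeffs_subset.2 fun x hx => ?_
    obtain ⟨γ, -, rfl⟩ := mem_coeffs_iff.1 hx
    rw [mul_comm, ← map_pow, coeff_C_mul, mul_comm]
    exact hT j g hg γ
  have := isIntegral_iff_isIntegral_coeff.1 hint β
  rwa [mul_comm, coeff_C_mul, mul_comm] at this

/-- The terms of an element integral over a monomial ideal have a power lying in the
corresponding power of the ideal. -/
theorem IdealIntegral.exists_monomial_nsmul_mem {σ R : Type*} [CommRing R] [IsDomain R]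
    {J : Ideal (MvPolynomial σ R)}
    (hJ : ∀ k, ∀ g ∈ J ^ k, ∀ β ∈ g.support, ∀ r : R, monomial β r ∈ J ^ k)
    {f : MvPolynomial σ R} (hf : IdealIntegral J f) {β : σ →₀ ℕ} (hβ : β ∈ f.support) :
    ∃ N, 0 < N ∧ monomial (N • β) (1 : R) ∈ J ^ N := by
  classical
  have hJ' : ∀ k, ∀ g ∈ J ^ k, ∀ γ, monomial γ (coeff γ g) ∈ J ^ k := by
    intro k g hg γ
    by_cases h : γ ∈ g.support
    · exact hJ k g hg γ h _
    · rw [notMem_support_iff.1 h, monomial_zero]; exact zero_mem _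
  let Φ : MvPolynomial σ R →+* MvPolynomial σ (Polynomial (MvPolynomial σ R)) :=
    (MvPolynomial.map Polynomial.C).comp (multidegreeHom σ R).toRingHom
  have hΦ : ∀ g γ, coeff γ (Φ g) = Polynomial.C (monomial γ (coeff γ g)) := by
    intro g γ
    simp [Φ, coeff_map, coeff_multidegreeHom]
  have hint : IsIntegral (reesAlgebra J)
      (Polynomial.C (monomial β (coeff β f)) * Polynomial.X) := by
    rw [← hΦ]
    refine hf.isIntegral_coeff_map_mul Φ Polynomial.X (fun j g hg γ => ?_) β
    rw [hΦ, Polynomial.C_mul_X_pow_eq_monomial]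
    exact ⟨⟨_, reesAlgebra.monomial_mem.2 (hJ' j g hg γ)⟩, rfl⟩
  obtain ⟨p, hp, e⟩ := hint
  set M := p.natDegree with hM
  replace e := congrArg (fun q => coeff (M • β) (q.coeff M)) e
  simp only [Polynomial.eval₂_eq_sum_range, Finset.sum_range_succ, Polynomial.coeff_add,
    Polynomial.finsetSum_coeff, Polynomial.coeff_zero, coeff_add, coeff_sum, coeff_zero] at e
  have hterm : ∀ i ∈ Finset.range (M + 1), ((algebraMap (reesAlgebra J) _ (p.coeff i)) *
      (Polynomial.C (monomial β (coeff β f)) * Polynomial.X) ^ i).coeff M =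
      (p.coeff i).1.coeff (M - i) * monomial (i • β) (coeff β f ^ i) := by
    intro i hi
    rw [mul_pow, ← map_pow, mul_left_comm, Polynomial.coeff_C_mul, Polynomial.coeff_mul_X_pow',
      if_pos (Nat.lt_succ_iff.1 (Finset.mem_range.1 hi)), mul_comm, monomial_pow]
    rfl
  have hlead : coeff (M • β) (((algebraMap (reesAlgebra J) _ (p.coeff M)) *
      (Polynomial.C (monomial β (coeff β f)) * Polynomial.X) ^ M).coeff M) ≠ 0 := by
    rw [hterm M (by simp), hM, hp.coeff_natDegree]
    simpa using pow_ne_zero _ (mem_support_iff.1 hβ)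
  obtain ⟨i, hi, hne⟩ := Finset.exists_ne_zero_of_sum_ne_zero
    (fun h0 => hlead (by rwa [h0, zero_add] at e))
  have hiM := Finset.mem_range.1 hi
  rw [hterm i (Finset.mem_range.2 (by omega)), coeff_mul_monomial'] at hne
  have hsub : M • β - i • β = (M - i) • β := by
    ext x
    simp [Nat.sub_mul]
  split_ifs at hne with hle
  · refine ⟨M - i, by omega, hJ _ _ ((p.coeff i).2 (M - i)) _ ?_ 1⟩
    rw [mem_support_iff, ← hsub]
    exact left_ne_zero_of_mul hne
  · exact absurd rfl hne

/-- Let `I` be a monomial ideal in `K[x_1, …, x_n]`, `n ≥ 1`.  If `I^m` is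
integrally closed for `m = 1, …, n − 1`, then `I` is normal: `I^m` is integrally closed
for every positive integer `m`. -/
theorem monomial_ideal_normal_of_first_powers_integrally_closed
    {K : Type*} [Field K] {n : ℕ} (hn : 1 ≤ n)
    (I : Ideal (MvPolynomial (Fin n) K))
    -- `I` is a monomial ideal
    (hI : ∃ A : Set (Fin n →₀ ℕ),
      I = Ideal.span ((fun α => MvPolynomial.monomial α (1 : K)) '' A))
    (hpow : ∀ m : ℕ, 1 ≤ m → m ≤ n - 1 →
      ∀ x : MvPolynomial (Fin n) K, IdealIntegral (I ^ m) x → x ∈ I ^ m) :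
    ∀ m : ℕ, 0 < m →
      ∀ x : MvPolynomial (Fin n) K, IdealIntegral (I ^ m) x → x ∈ I ^ m := by
  obtain ⟨A, rfl⟩ := hI
  intro m
  induction m with
  | zero => exact fun h => absurd h (lt_irrefl 0)
  | succ m ih =>
    intro _ f hf
    rcases le_or_gt (m + 1) (n - 1) with hmn | hmn
    · exact hpow (m + 1) (by omega) hmn f hf
    by_cases hA : 0 ∈ A
    · have htop : Ideal.span ((fun α => monomial α (1 : K)) '' A) = ⊤ :=
        (Ideal.eq_top_iff_one _).2 (monomial_mem_span hA)
      rw [htop, Ideal.top_pow]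
      trivial
    rw [f.as_sum]
    refine sum_mem fun β hβ => ?_
    obtain ⟨N, hN, hNβ⟩ := hf.exists_monomial_nsmul_mem (fun k g hg γ hγ r => by
      rw [← pow_mul] at hg ⊢
      exact monomial_mem_span_pow_of_mem_support hg hγ r) hβ
    rw [← pow_mul] at hNβ
    obtain ⟨a, ha, haβ, M, hM, hMβ⟩ := exists_le_and_monomial_nsmul_sub_mem hA
      (by rw [Fintype.card_fin]; omega) m.succ_pos hN hNβ
    rw [Nat.succ_sub_one, pow_mul] at hMβ
    have hmem : monomial (β - a) (1 : K) ∈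
        Ideal.span ((fun α => monomial α (1 : K)) '' A) ^ m := by
      rcases m.eq_zero_or_pos with rfl | hm
      · simp
      · exact ih hm _ (idealIntegral_monomial hM hMβ)
    refine monomial_mem_of_le le_rfl ?_ _
    have := Ideal.mul_mem_mul hmem (monomial_mem_span (R := K) ha)
    rwa [← pow_succ, monomial_mul, tsub_add_cancel_of_le haβ, one_mul] at this
end

section
/- Let λ = (λ_1,…,λ_n) be a vector of positive integers, L = lcm(λ_1,…,λ_n), and ω_i = L/λ_i. Then the exponent set Γ of the ideal I(λ) satisfies Γ = { α = (a_1,…,a_n) ∈ ℕ^n | a_1/λ_1 + ⋯ + a_n/λ_n ≥ 1 } = { α ∈ ℕ^n | ω_1 a_1 + ⋯ + ω_n a_n ≥ L }; that is, a monomial x^α lies in I(λ) if and only if ω_1 a_1 + ⋯ + ω_n a_n ≥ L. -/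
/-- The ideal of polynomials all of whose monomials have `w`-weight at least `k`. -/
def MvPolynomial.weightGEIdeal {σ : Type*} (R : Type*) [CommSemiring R] (w : σ → ℕ) (k : ℕ) :
    Ideal (MvPolynomial σ R) where
  carrier := {f | ∀ β ∈ f.support, k ≤ Finsupp.weight w β}
  zero_mem' := by simp
  add_mem' {f g} hf hg β hβ := by
    classical
    exact (Finset.mem_union.mp (MvPolynomial.support_add hβ)).elim (hf β) (hg β)
  smul_mem' f g hg β hβ := by
    classical
    obtain ⟨γ, -, δ, hδ, rfl⟩ := Finset.mem_add.mp (MvPolynomial.support_mul f g hβ)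
    rw [map_add]
    exact (hg δ hδ).trans (Nat.le_add_left _ _)

theorem MvPolynomial.mem_weightGEIdeal {σ R : Type*} [CommSemiring R] {w : σ → ℕ} {k : ℕ}
    {f : MvPolynomial σ R} :
    f ∈ weightGEIdeal R w k ↔ ∀ β ∈ f.support, k ≤ Finsupp.weight w β :=
  Iff.rfl

theorem MvPolynomial.pow_le_weightGEIdeal {σ R : Type*} [CommSemiring R] {w : σ → ℕ} {k : ℕ}
    {J : Ideal (MvPolynomial σ R)} (hJ : J ≤ weightGEIdeal R w k) (j : ℕ) :
    J ^ j ≤ weightGEIdeal R w (j * k) := by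
  classical
  induction j with
  | zero => exact fun f _ β _ => by simp
  | succ j ih =>
    rw [pow_succ, Ideal.mul_le]
    intro f hf g hg β hβ
    obtain ⟨γ, hγ, δ, hδ, rfl⟩ := Finset.mem_add.mp (support_mul f g hβ)
    rw [map_add, add_mul, one_mul]
    exact Nat.add_le_add (ih hf γ hγ) (hJ hg δ hδ)

theorem MvPolynomial.span_X_pow_le_weightGEIdeal {σ R : Type*} [CommSemiring R] {w lam : σ → ℕ}
    {k : ℕ} (h : ∀ i, k ≤ lam i * w i) :
    Ideal.span (Set.range fun i => (X i : MvPolynomial σ R) ^ lam i) ≤ weightGEIdeal R w k := by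
  classical
  rw [Ideal.span_le]
  rintro _ ⟨i, rfl⟩ β hβ
  simp only [X_pow_eq_monomial] at hβ
  obtain rfl := Finset.mem_singleton.mp (support_monomial_subset hβ)
  simpa [Finsupp.weight_single] using h i

theorem IdealIntegral.of_pow_mem {R : Type*} [CommRing R] {I : Ideal R} {x : R} {m : ℕ}
    (hm : 0 < m) (h : x ^ m ∈ I ^ m) : IdealIntegral I x := by
  refine ⟨m, hm, Pi.single m (-x ^ m), fun j _ => ?_, ?_⟩
  · rcases eq_or_ne j m with rfl | hj
    · simpa using h
    · simp [hj]
  · rw [Finset.sum_eq_single_of_mem m (Finset.mem_Icc.mpr ⟨hm, le_rfl⟩)]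
    · simp
    · intro j _ hj
      simp [hj]

theorem IdealIntegral.le_weight_of_monomial {σ R : Type*} [CommRing R] [Nontrivial R]
    {w : σ → ℕ} {k : ℕ} {J : Ideal (MvPolynomial σ R)}
    (hJ : J ≤ MvPolynomial.weightGEIdeal R w k) {α : σ →₀ ℕ}
    (h : IdealIntegral J (MvPolynomial.monomial α (1 : R))) : k ≤ Finsupp.weight w α := by
  classical
  obtain ⟨m, -, a, ha, heq⟩ := h
  have hcoeff := congrArg (MvPolynomial.coeff (m • α)) heq
  simp only [MvPolynomial.monomial_pow, one_pow, MvPolynomial.coeff_add, MvPolynomial.coeff_sum,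
    MvPolynomial.coeff_monomial, if_true, MvPolynomial.coeff_zero] at hcoeff
  obtain ⟨j, hj, hne⟩ := Finset.exists_ne_zero_of_sum_ne_zero
    ((eq_neg_of_add_eq_zero_right hcoeff).trans_ne (neg_ne_zero.mpr one_ne_zero))
  obtain ⟨hj1, hjm⟩ := Finset.mem_Icc.mp hj
  have hsplit : m • α = j • α + (m - j) • α := by rw [← add_smul, Nat.add_sub_cancel' hjm]
  rw [hsplit, MvPolynomial.coeff_mul_monomial, mul_one] at hne
  have hle := MvPolynomial.pow_le_weightGEIdeal hJ j (ha j hj) (j • α)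
    (MvPolynomial.mem_support_iff.mpr hne)
  rw [map_nsmul, smul_eq_mul] at hle
  exact Nat.le_of_mul_le_mul_left hle hj1

theorem MvPolynomial.monomial_pow_mem_span_X_pow {σ R : Type*} [Fintype σ] [CommSemiring R]
    {w lam : σ → ℕ} {L : ℕ} (hw : ∀ i, lam i * w i = L) {α : σ →₀ ℕ}
    (h : L ≤ ∑ i, w i * α i) :
    monomial α (1 : R) ^ L ∈
      Ideal.span (Set.range fun i => (X i : MvPolynomial σ R) ^ lam i) ^ L := by
  refine Ideal.pow_le_pow_right h ?_
  have hprod : monomial α (1 : R) ^ L = ∏ i, (X i ^ lam i) ^ (w i * α i) := by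
    rw [monomial_eq, map_one, one_mul, Finsupp.prod_fintype _ _ (fun i => pow_zero _),
      ← Finset.prod_pow]
    refine Finset.prod_congr rfl fun i _ => ?_
    rw [← pow_mul, ← pow_mul, ← mul_assoc, hw, mul_comm]
  rw [hprod, ← Finset.prod_pow_eq_pow_sum]
  exact Ideal.prod_mem_prod fun i _ =>
    Ideal.pow_mem_pow (Ideal.subset_span (Set.mem_range_self i)) _

/-- Let `λ` be a vector of positive integers, `L = lcm(λ_1, …, λ_n)`,
`ω_i = L / λ_i`, `J(λ) = (x_1^{λ_1}, …, x_n^{λ_n})` and `I(λ) = \overline{J(λ)}`.  Then the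
exponent set of `I(λ)` is `{α ∈ ℕ^n | a_1/λ_1 + ⋯ + a_n/λ_n ≥ 1} =
{α ∈ ℕ^n | ω_1 a_1 + ⋯ + ω_n a_n ≥ L}`: a monomial `x^α` lies in `I(λ)` iff
`ω·α ≥ L`, iff `Σ a_i/λ_i ≥ 1`. -/
theorem exponent_set_of_I_lambda
    {K : Type*} [Field K] {n : ℕ} (hn : 0 < n)
    (lam : Fin n → ℕ) (hlam : ∀ i, 0 < lam i)
    (L : ℕ) (hL : L = Finset.univ.lcm lam)
    (ω : Fin n → ℕ) (hω : ∀ i, ω i = L / lam i)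
    (J : Ideal (MvPolynomial (Fin n) K))
    (hJ : J = Ideal.span (Set.range fun i => (MvPolynomial.X i : MvPolynomial (Fin n) K) ^ lam i))
    (α : Fin n →₀ ℕ) :
    (IdealIntegral J (MvPolynomial.monomial α (1 : K)) ↔
        (1 : ℚ) ≤ ∑ i, (α i : ℚ) / (lam i : ℚ)) ∧
    (IdealIntegral J (MvPolynomial.monomial α (1 : K)) ↔
        L ≤ ∑ i, ω i * α i) := by
  have hdvd : ∀ i, lam i ∣ L := fun i => hL ▸ Finset.dvd_lcm (Finset.mem_univ i)
  have hw : ∀ i, lam i * ω i = L := fun i => by rw [hω, Nat.mul_div_cancel' (hdvd i)]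
  have hL0 : 0 < L := by
    rw [hL, Nat.pos_iff_ne_zero, Ne, Finset.lcm_eq_zero_iff]
    rintro ⟨i, -, hi⟩
    exact (hlam i).ne' hi
  have hmem : IdealIntegral J (MvPolynomial.monomial α (1 : K)) ↔ L ≤ ∑ i, ω i * α i := by
    subst hJ
    refine ⟨fun h => ?_, fun h => .of_pow_mem hL0 (MvPolynomial.monomial_pow_mem_span_X_pow hw h)⟩
    have hle := h.le_weight_of_monomial
      (MvPolynomial.span_X_pow_le_weightGEIdeal fun i => (hw i).ge)
    rwa [Finsupp.weight_apply, Finsupp.sum_fintype _ _ (by simp),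
      Finset.sum_congr rfl fun i _ => (smul_eq_mul (α i) (ω i)).trans (mul_comm _ _)] at hle
  refine ⟨hmem.trans ?_, hmem⟩
  have hLQ : (0 : ℚ) < L := by exact_mod_cast hL0
  have hsum : ((∑ i, ω i * α i : ℕ) : ℚ) = L * ∑ i, (α i : ℚ) / (lam i : ℚ) := by
    rw [Finset.mul_sum, Nat.cast_sum]
    refine Finset.sum_congr rfl fun i _ => ?_
    have hi : (lam i : ℚ) ≠ 0 := by exact_mod_cast (hlam i).ne'
    rw [← hw i]
    push_cast
    field_simp
  rw [← Nat.cast_le (α := ℚ), hsum, le_mul_iff_one_le_right hLQ]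
end

section
/- Let n ≥ 3 and let λ = (λ_1,…,λ_n) be a vector of positive integers with gcd(λ_1,…,λ_n) > n − 2. Then the monomial ideal I(λ) ⊆ K[x_1,…,x_n] is normal. -/
/-- The grading homomorphism `X i ↦ X i * T ^ p i` of a weight vector `p`. -/
noncomputable def weightHom (K : Type*) [Field K] {n : ℕ} (p : Fin n → ℕ) :
    MvPolynomial (Fin n) K →ₐ[K] Polynomial (MvPolynomial (Fin n) K) :=
  MvPolynomial.aeval fun i =>
    Polynomial.C (MvPolynomial.X i) * (Polynomial.X : Polynomial (MvPolynomial (Fin n) K)) ^ p i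

theorem weightHom_monomial {K : Type*} [Field K] {n : ℕ} (p : Fin n → ℕ) (s : Fin n →₀ ℕ)
    (c : K) : weightHom K p (MvPolynomial.monomial s c) =
      Polynomial.monomial (∑ i, s i * p i) (MvPolynomial.monomial s c) := by
  rw [weightHom, MvPolynomial.aeval_monomial, Finsupp.prod_fintype _ _ (fun i => pow_zero _)]
  simp only [mul_pow, Finset.prod_mul_distrib, ← pow_mul, Finset.prod_pow_eq_pow_sum]
  rw [← Polynomial.C_mul_X_pow_eq_monomial, MvPolynomial.monomial_eq,
    Finsupp.prod_fintype _ _ (fun i => pow_zero _), IsScalarTower.algebraMap_apply K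
      (MvPolynomial (Fin n) K) (Polynomial (MvPolynomial (Fin n) K)),
    MvPolynomial.algebraMap_eq, Polynomial.algebraMap_eq]
  simp only [map_mul, map_prod, map_pow, mul_assoc, mul_comm (p _)]

theorem coeff_coeff_weightHom {K : Type*} [Field K] {n : ℕ} (p : Fin n → ℕ)
    (f : MvPolynomial (Fin n) K) (s : Fin n →₀ ℕ) :
    ((weightHom K p f).coeff (∑ i, s i * p i)).coeff s = f.coeff s := by
  induction f using MvPolynomial.induction_on' with
  | monomial t c =>
    rw [weightHom_monomial, Polynomial.coeff_monomial]
    by_cases h : t = s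
    · subst h; simp
    · split_ifs <;> simp [MvPolynomial.coeff_monomial, h]
  | add f g hf hg => simp [hf, hg]

/-- The ideal of polynomials all of whose monomials have `p`-weight at least `d`. -/
noncomputable def weightIdeal (K : Type*) [Field K] {n : ℕ} (p : Fin n → ℕ) (d : ℕ) :
    Ideal (MvPolynomial (Fin n) K) :=
  (Ideal.span {(Polynomial.X : Polynomial (MvPolynomial (Fin n) K)) ^ d}).comap (weightHom K p)

theorem mem_weightIdeal {K : Type*} [Field K] {n : ℕ} {p : Fin n → ℕ} {d : ℕ}
    {f : MvPolynomial (Fin n) K} :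
    f ∈ weightIdeal K p d ↔ Polynomial.X ^ d ∣ weightHom K p f := by
  rw [weightIdeal, Ideal.mem_comap, Ideal.mem_span_singleton]

theorem le_weight_of_mem_weightIdeal {K : Type*} [Field K] {n : ℕ} {p : Fin n → ℕ} {d : ℕ}
    {f : MvPolynomial (Fin n) K} (hf : f ∈ weightIdeal K p d) {s : Fin n →₀ ℕ}
    (hs : s ∈ f.support) : d ≤ ∑ i, s i * p i := by
  by_contra! h
  rw [MvPolynomial.mem_support_iff] at hs
  apply hs
  rw [← coeff_coeff_weightHom p, Polynomial.X_pow_dvd_iff.1 (mem_weightIdeal.1 hf) _ h]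
  simp

theorem weightIdeal_pow_le {K : Type*} [Field K] {n : ℕ} (p : Fin n → ℕ) (d j : ℕ) :
    weightIdeal K p d ^ j ≤ weightIdeal K p (d * j) := by
  refine (Ideal.le_comap_pow _ j).trans ?_
  rw [weightIdeal, Ideal.span_singleton_pow, pow_mul]

theorem Prime.pow_dvd_of_integral {R : Type*} [CommRing R] [IsDomain R] {t : R} (ht : Prime t)
    {d m : ℕ} {x : R} {a : ℕ → R} (hm : 0 < m) (ha : ∀ j ∈ Finset.Icc 1 m, t ^ (d * j) ∣ a j)
    (h : x ^ m + ∑ j ∈ Finset.Icc 1 m, a j * x ^ (m - j) = 0) : t ^ d ∣ x := by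
  suffices H : ∀ e ≤ d, t ^ e ∣ x from H d le_rfl
  intro e
  induction e with
  | zero => simp
  | succ e ih =>
    intro he
    obtain ⟨u, rfl⟩ := ih (by omega)
    have hdvd : t ^ (e * m + 1) ∣ (t ^ e * u) ^ m := by
      rw [eq_neg_of_add_eq_zero_left h, dvd_neg]
      refine Finset.dvd_sum fun j hj => ?_
      have hj' := Finset.mem_Icc.1 hj
      obtain ⟨i, rfl⟩ := Nat.exists_eq_add_of_le hj'.2
      have h1 : t ^ (d * j + e * i) ∣ a j * (t ^ e * u) ^ (j + i - j) := by
        rw [pow_add, Nat.add_sub_cancel_left, mul_pow, ← pow_mul]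
        exact mul_dvd_mul (ha j hj) (dvd_mul_right _ _)
      refine (pow_dvd_pow t ?_).trans h1
      nlinarith [Nat.mul_le_mul_right j he]
    rw [mul_pow, ← pow_mul, pow_succ,
      mul_dvd_mul_iff_left (pow_ne_zero _ ht.ne_zero)] at hdvd
    rw [pow_succ]
    exact mul_dvd_mul_left _ (ht.dvd_of_dvd_pow hdvd)

theorem IdealIntegral.mem_weightIdeal {K : Type*} [Field K] {n : ℕ} {p : Fin n → ℕ} {d : ℕ}
    {I : Ideal (MvPolynomial (Fin n) K)} (hI : I ≤ weightIdeal K p d)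
    {x : MvPolynomial (Fin n) K} (hx : IdealIntegral I x) : x ∈ weightIdeal K p d := by
  obtain ⟨m, hm, a, ha, h⟩ := hx
  rw [_root_.mem_weightIdeal]
  refine Polynomial.prime_X.pow_dvd_of_integral (a := fun j => weightHom K p (a j)) hm
    (fun j hj => ?_) ?_
  · exact _root_.mem_weightIdeal.1 (weightIdeal_pow_le p d j (Ideal.pow_right_mono hI j (ha j hj)))
  · simpa using congrArg (weightHom K p) h

theorem idealIntegral_of_pow_mem {R : Type*} [CommRing R] {I : Ideal R} {x : R} {m : ℕ}
    (hm : 0 < m) (hx : x ^ m ∈ I ^ m) : IdealIntegral I x := by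
  refine ⟨m, hm, fun j => if j = m then -x ^ m else 0, fun j _ => ?_, ?_⟩
  · dsimp only
    split_ifs with h
    · subst h; exact neg_mem hx
    · exact zero_mem _
  · rw [Finset.sum_eq_single m] <;> simp +contextual
    omega

theorem exists_le_sum_eq {ι : Type*} [Fintype ι] [DecidableEq ι] (c : ι → ℕ) (g : ℕ)
    (hg : g ≤ ∑ i, c i) : ∃ d ≤ c, ∑ i, d i = g := by
  induction g with
  | zero => exact ⟨0, fun i => Nat.zero_le _, by simp⟩
  | succ g ih =>
    obtain ⟨d, hd, hsum⟩ := ih (by omega)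
    obtain ⟨i, -, hi⟩ := Finset.exists_lt_of_sum_lt (s := Finset.univ) (f := d) (g := c) (by omega)
    refine ⟨d + Pi.single i 1, fun j => ?_, by simp [Finset.sum_add_distrib, hsum]⟩
    by_cases h : j = i
    · subst h; simpa using hi
    · simpa [h] using hd j

/-- If the weights satisfy `p i * μ i = M`, a vector of weight at least `2 g M` dominates one of
weight exactly `g M`, provided `n ≤ g + 1`. -/
theorem exists_le_weight_eq {n g M : ℕ} {p μ : Fin n → ℕ} (hM : 0 < M) (hμ : ∀ i, p i * μ i = M)
    (hg : n ≤ g + 1) (hn : 0 < n) (s : Fin n →₀ ℕ) (hs : 2 * g * M ≤ ∑ i, s i * p i) :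
    ∃ b ≤ s, ∑ i, b i * p i = g * M := by
  have hμ0 : ∀ i, 0 < μ i := fun i => Nat.pos_of_mul_pos_left (by rw [hμ i]; exact hM)
  have hp0 : ∀ i, 0 < p i := fun i => Nat.pos_of_mul_pos_right (by rw [hμ i]; exact hM)
  have hlt : ∑ i, s i * p i < ∑ i, (s i / μ i + 1) * M := by
    have : Nonempty (Fin n) := ⟨⟨0, hn⟩⟩
    refine Finset.sum_lt_sum_of_nonempty Finset.univ_nonempty fun i _ => ?_
    calc s i * p i < (μ i * (s i / μ i + 1)) * p i :=
          Nat.mul_lt_mul_of_pos_right (Nat.lt_mul_div_succ _ (hμ0 i)) (hp0 i)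
      _ = (s i / μ i + 1) * M := by rw [← hμ i]; ring
  rw [← Finset.sum_mul, Finset.sum_add_distrib] at hlt
  have hlt' := Nat.lt_of_mul_lt_mul_right (hs.trans_lt hlt)
  simp only [Finset.sum_const, Finset.card_univ, Fintype.card_fin, smul_eq_mul, mul_one] at hlt'
  obtain ⟨d, hd, hsum⟩ := exists_le_sum_eq (fun i => s i / μ i) g (by omega)
  refine ⟨Finsupp.equivFunOnFinite.symm fun i => d i * μ i, fun i => ?_, ?_⟩
  · exact (Nat.mul_le_mul_right _ (hd i)).trans (Nat.div_mul_le_self _ _)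
  · rw [← hsum, Finset.sum_mul]
    refine Finset.sum_congr rfl fun i _ => ?_
    simp only [Finsupp.equivFunOnFinite_symm_apply_apply]
    rw [← hμ i]; ring

theorem idealIntegral_monomial_s12 {K : Type*} [Field K] {n m : ℕ} {lam p : Fin n → ℕ} (hm : 0 < m)
    (hp : ∀ i, p i * lam i = m) {s : Fin n →₀ ℕ} (hs : m ≤ ∑ i, s i * p i) :
    IdealIntegral (Ideal.span
      (Set.range fun i => (MvPolynomial.X i : MvPolynomial (Fin n) K) ^ lam i))
      (MvPolynomial.monomial s 1) := by
  refine idealIntegral_of_pow_mem hm (Ideal.pow_le_pow_right hs ?_)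
  rw [MvPolynomial.monomial_eq, Finsupp.prod_fintype _ _ (fun i => pow_zero _), map_one, one_mul,
    ← Finset.prod_pow, ← Finset.prod_pow_eq_pow_sum]
  refine Ideal.prod_mem_prod fun i _ => ?_
  have h : ((MvPolynomial.X i : MvPolynomial (Fin n) K) ^ s i) ^ m =
      (MvPolynomial.X i ^ lam i) ^ (s i * p i) := by
    rw [← pow_mul, ← pow_mul, ← hp i]; ring_nf
  rw [h]
  exact Ideal.pow_mem_pow (Ideal.subset_span (Set.mem_range_self i)) _

/-- Let `n ≥ 3` and `λ = (λ_1, …, λ_n)` positive integers with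
`gcd(λ_1, …, λ_n) > n − 2`.  Then `I(λ) = \overline{(x_1^{λ_1}, …, x_n^{λ_n})}` is normal. -/
theorem I_lambda_normal_of_gcd_large
    {K : Type*} [Field K] {n : ℕ} (hn : 3 ≤ n)
    (lam : Fin n → ℕ) (hlam : ∀ i, 0 < lam i)
    (hgcd : n - 2 < Finset.univ.gcd lam)
    (J Ilam : Ideal (MvPolynomial (Fin n) K))
    (hJ : J = Ideal.span (Set.range fun i => (MvPolynomial.X i : MvPolynomial (Fin n) K) ^ lam i))
    -- `I(λ)` is the integral closure of `J(λ)`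
    (hIlam : ∀ x : MvPolynomial (Fin n) K, x ∈ Ilam ↔ IdealIntegral J x) :
    ∀ k : ℕ, 0 < k → ∀ x : MvPolynomial (Fin n) K,
      IdealIntegral (Ilam ^ k) x → x ∈ Ilam ^ k := by
  subst hJ
  set g := Finset.univ.gcd lam
  set m := ∏ i, lam i
  have hm : 0 < m := Finset.prod_pos fun i _ => hlam i
  choose p hp using fun i => Finset.dvd_prod_of_mem lam (Finset.mem_univ i)
  choose μ hμ using fun i => Finset.gcd_dvd (f := lam) (Finset.mem_univ i)
  have hp' : ∀ i, p i * lam i = m := fun i => by rw [mul_comm, ← hp i]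
  have hM : ∀ i, p i * μ i = m / g := fun i => by
    rw [← hp' i]
    refine (Nat.div_eq_of_eq_mul_right (by omega) ?_).symm
    calc p i * lam i = p i * (g * μ i) := by rw [← hμ i]
      _ = _ := by ring
  have hgm : g * (m / g) = m := by
    let i : Fin n := ⟨0, by omega⟩
    exact Nat.mul_div_cancel' ((Dvd.intro _ (hμ i).symm).trans (Dvd.intro _ (hp i).symm))
  have hM0 : 0 < m / g := Nat.pos_of_mul_pos_left (by rw [hgm]; exact hm)
  have hJle : Ideal.span (Set.range fun i => (MvPolynomial.X i : MvPolynomial (Fin n) K) ^ lam i)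
      ≤ weightIdeal K p m := by
    rw [Ideal.span_le]
    rintro _ ⟨i, rfl⟩
    rw [SetLike.mem_coe, mem_weightIdeal, map_pow, weightHom, MvPolynomial.aeval_X, mul_pow,
      ← pow_mul, hp' i]
    exact dvd_mul_left _ _
  have hIle : Ilam ≤ weightIdeal K p m := fun x hx => ((hIlam x).1 hx).mem_weightIdeal hJle
  have key : ∀ k : ℕ, ∀ s : Fin n →₀ ℕ, m * (k + 1) ≤ ∑ i, s i * p i →
      (MvPolynomial.monomial s 1 : MvPolynomial (Fin n) K) ∈ Ilam ^ (k + 1) := by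
    intro k
    induction k with
    | zero =>
      intro s hs
      rw [zero_add, pow_one, hIlam]
      exact idealIntegral_monomial_s12 hm hp' (by simpa using hs)
    | succ k ih =>
      intro s hs
      obtain ⟨b, hbs, hb⟩ := exists_le_weight_eq (g := g) hM0 hM (by omega) (by omega) s
        (by rw [mul_assoc, hgm]; nlinarith)
      obtain ⟨c, rfl⟩ := exists_add_of_le hbs
      simp only [Finsupp.add_apply, add_mul, Finset.sum_add_distrib, hb, hgm] at hs
      rw [← one_mul (1 : K), ← MvPolynomial.monomial_mul, pow_succ']
      refine Ideal.mul_mem_mul ?_ (ih c (by linarith))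
      rw [hIlam]
      exact idealIntegral_monomial_s12 hm hp' (by rw [hb, hgm])
  intro k hk x hx
  obtain ⟨k, rfl⟩ := Nat.exists_eq_add_of_lt hk
  rw [zero_add] at hx ⊢
  have hxw := hx.mem_weightIdeal
    ((Ideal.pow_right_mono hIle _).trans (weightIdeal_pow_le p m (k + 1)))
  rw [x.as_sum]
  refine Ideal.sum_mem _ fun s hs => ?_
  rw [← mul_one (x.coeff s), ← MvPolynomial.C_mul_monomial]
  exact Ideal.mul_mem_left _ _ (key k s (le_weight_of_mem_weightIdeal hxw hs))
end
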